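/- arXiv:math/0508409 — 2 statements merged into one kernel-verified Lean document; each statement's English description precedes it below -/
import Mathlib

section
/- Let p ≥ 5 be a prime. Then Σ_{j=1}^{(p−1)/2} 1/[j]_{q^2} ≡ −(1+q)·Q_p(2,q) (mod [p]_q). -/
open Polynomial Finset

/-- The indeterminate `q` as an element of the rational function field `ℚ(q)`. -/
noncomputable def q : RatFunc ℚ := algebraMap (Polynomial ℚ) (RatFunc ℚ) Polynomial.X

/-- The `q`-integer `[n]_a = 1 + a + ⋯ + a^(n-1)` with base `a ∈ ℚ(q)`. -/
noncomputable def qn (a : RatFunc ℚ) (n : ℕ) : RatFunc ℚ := ∑ i ∈ Finset.range n, a ^ i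

/-- The `q`-Pochhammer symbol `(x; a)_n = ∏_{i=0}^{n-1} (1 - x a^i)`. -/
noncomputable def qpoch (x a : RatFunc ℚ) (n : ℕ) : RatFunc ℚ :=
  ∏ i ∈ Finset.range n, (1 - x * a ^ i)

/-- The Gaussian binomial coefficient `[n choose k]_a = (a;a)_n / ((a;a)_k (a;a)_{n-k})`. -/
noncomputable def qbinom (a : RatFunc ℚ) (n k : ℕ) : RatFunc ℚ :=
  qpoch a a n / (qpoch a a k * qpoch a a (n - k))

/-- The polynomial `q`-integer `[n]_a = 1 + a + ⋯ + a^(n-1)` with base `a ∈ ℚ[q]`. -/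
noncomputable def pqn (a : Polynomial ℚ) (n : ℕ) : Polynomial ℚ := ∑ i ∈ Finset.range n, a ^ i

/-- `A ≡ B (mod g)`: the rational function `(A - B)/g`, written in lowest terms,
has denominator coprime to `g`. -/
def qCong (g : Polynomial ℚ) (A B : RatFunc ℚ) : Prop :=
  IsCoprime (((A - B) / algebraMap (Polynomial ℚ) (RatFunc ℚ) g).denom) g

/-- The `q`-Fermat quotient `Q_p(m, a) = ((a^m; a^m)_{p-1} / (a; a)_{p-1} - 1) / [p]_a`. -/
noncomputable def QF (p m : ℕ) (a : RatFunc ℚ) : RatFunc ℚ :=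
  (qpoch (a ^ m) (a ^ m) (p - 1) / qpoch a a (p - 1) - 1) / qn a p

/-- `⟨x⟩_p`: the least non-negative residue of the integer `x` modulo `p`. -/
def res (p : ℕ) (x : ℤ) : ℕ := (x % (p : ℤ)).toNat

/-- `R_p(m) = {j : 1 ≤ j < p/2, ⟨jm⟩_p > p/2}` (for odd `p`, `1 ≤ j < p/2` means
`1 ≤ j ≤ (p-1)/2`, and `⟨jm⟩_p > p/2` means `2⟨jm⟩_p > p`). -/
def Rset (p : ℕ) (m : ℤ) : Finset ℕ :=
  (Finset.Icc 1 ((p - 1) / 2)).filter fun j => p < 2 * res p ((j : ℤ) * m)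

/-- The rational functions whose reduced denominator is coprime to `g`. -/
def coprimeDenomSubring (g : Polynomial ℚ) : Subring (RatFunc ℚ) where
  carrier := {f | IsCoprime f.denom g}
  mul_mem' ha hb := (ha.mul_left hb).of_isCoprime_of_dvd_left (RatFunc.denom_mul_dvd _ _)
  one_mem' := by simpa using isCoprime_one_left
  add_mem' ha hb := (ha.mul_left hb).of_isCoprime_of_dvd_left (RatFunc.denom_add_dvd _ _)
  zero_mem' := by simpa using isCoprime_one_left
  neg_mem' {x} hx := by
    have h := RatFunc.denom_mul_dvd (algebraMap (Polynomial ℚ) (RatFunc ℚ) (-1)) x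
    rw [RatFunc.denom_algebraMap, one_mul, map_neg, map_one, neg_one_mul] at h
    exact hx.of_isCoprime_of_dvd_left h

theorem q_mem_coprimeDenomSubring (g : Polynomial ℚ) : q ∈ coprimeDenomSubring g := by
  change IsCoprime (RatFunc.denom q) g
  rw [q, RatFunc.denom_algebraMap]
  exact isCoprime_one_left

theorem inv_algebraMap_mem_coprimeDenomSubring {f g : Polynomial ℚ} (h : IsCoprime f g) :
    (algebraMap (Polynomial ℚ) (RatFunc ℚ) f)⁻¹ ∈ coprimeDenomSubring g := by
  have hd := RatFunc.denom_div_dvd 1 f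
  rw [map_one, one_div] at hd
  exact h.of_isCoprime_of_dvd_left hd

theorem algebraMap_pqn (n : ℕ) :
    algebraMap (Polynomial ℚ) (RatFunc ℚ) (pqn X n) = qn q n := by
  simp [pqn, qn, q]

theorem natDegree_pqn_succ (n : ℕ) : (pqn X (n + 1) : Polynomial ℚ).natDegree = n := by
  induction n with
  | zero => simp [pqn]
  | succ n ih =>
    have h : (pqn X (n + 1 + 1) : Polynomial ℚ) = pqn X (n + 1) + X ^ (n + 1) := by
      simp only [pqn, Finset.sum_range_succ]
    rw [h, natDegree_add_eq_right_of_natDegree_lt] <;> simp [ih]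

theorem pqn_ne_zero {n : ℕ} (hn : n ≠ 0) : (pqn X n : Polynomial ℚ) ≠ 0 := by
  intro h
  have := congrArg (eval 1) h
  simp [pqn, eval_finsetSum, hn] at this

theorem qn_ne_zero {n : ℕ} (hn : n ≠ 0) : qn q n ≠ 0 := by
  rw [← algebraMap_pqn]
  exact RatFunc.algebraMap_ne_zero (pqn_ne_zero hn)

theorem isCoprime_pqn_of_lt {p i : ℕ} (hp : p.Prime) (hi : i ≠ 0) (hip : i < p) :
    IsCoprime (pqn X i : Polynomial ℚ) (pqn X p) := by
  have hirr : Irreducible (pqn X p : Polynomial ℚ) := by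
    have := Fact.mk hp
    rw [pqn, ← cyclotomic_prime ℚ p]
    exact cyclotomic.irreducible_rat hp.pos
  refine (hirr.coprime_iff_not_dvd.2 (not_dvd_of_natDegree_lt (pqn_ne_zero hi) ?_)).symm
  obtain ⟨i, rfl⟩ := Nat.exists_eq_succ_of_ne_zero hi
  obtain ⟨p, rfl⟩ := Nat.exists_eq_succ_of_ne_zero hp.ne_zero
  rw [Nat.succ_eq_add_one, Nat.succ_eq_add_one, natDegree_pqn_succ, natDegree_pqn_succ]
  omega

theorem inv_qn_mem_coprimeDenomSubring {p i : ℕ} (hp : p.Prime) (hi : i ≠ 0) (hip : i < p) :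
    (qn q i)⁻¹ ∈ coprimeDenomSubring (pqn X p) := by
  rw [← algebraMap_pqn]
  exact inv_algebraMap_mem_coprimeDenomSubring (isCoprime_pqn_of_lt hp hi hip)

theorem qn_add (a : RatFunc ℚ) (m n : ℕ) : qn a (m + n) = qn a m + a ^ m * qn a n := by
  simp only [qn, Finset.sum_range_add, Finset.mul_sum, pow_add]

theorem qn_two_mul (a : RatFunc ℚ) (n : ℕ) : qn a (2 * n) = (1 + a) * qn (a ^ 2) n := by
  induction n with
  | zero => simp [qn]
  | succ n ih =>
    rw [mul_add, qn_add, qn_add, ih]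
    simp only [qn, Finset.sum_range_succ, Finset.sum_range_zero]
    ring

theorem one_sub_mul_qn (a : RatFunc ℚ) (n : ℕ) : (1 - a) * qn a n = 1 - a ^ n :=
  mul_neg_geom_sum a n

theorem one_sub_q_ne_zero : 1 - q ≠ 0 := by
  have h : (1 - X : Polynomial ℚ) ≠ 0 := fun h => by
    have := congrArg (eval 0) h
    simp at this
  simpa [q] using RatFunc.algebraMap_ne_zero h

theorem qpoch_self (a : RatFunc ℚ) (n : ℕ) :
    qpoch a a n = ∏ i ∈ Finset.range n, (1 - a ^ (i + 1)) := by
  simp only [qpoch, pow_succ']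

theorem prod_range_two_mul {M : Type*} [CommMonoid M] (f : ℕ → M) (n : ℕ) :
    ∏ i ∈ Finset.range (2 * n), f i =
      (∏ k ∈ Finset.range n, f (2 * k)) * ∏ k ∈ Finset.range n, f (2 * k + 1) := by
  induction n with
  | zero => simp
  | succ n ih =>
    rw [mul_add, mul_one, Finset.prod_range_succ, Finset.prod_range_succ, ih,
      Finset.prod_range_succ, Finset.prod_range_succ]
    simp only [mul_assoc, mul_left_comm, mul_comm]

theorem qpoch_sq_div_qpoch (n : ℕ) :
    qpoch (q ^ 2) (q ^ 2) (2 * n) / qpoch q q (2 * n) =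
      ∏ k ∈ Finset.range n,
        (1 + qn q (2 * n + 1) * (q ^ (2 * k + 1) * (qn q (2 * k + 1))⁻¹)) := by
  have hne : ∀ m : ℕ, m ≠ 0 → 1 - q ^ m ≠ 0 := fun m hm => by
    rw [← one_sub_mul_qn]
    exact mul_ne_zero one_sub_q_ne_zero (qn_ne_zero hm)
  rw [qpoch_self, qpoch_self, prod_range_two_mul (fun i => 1 - q ^ (i + 1)), two_mul n,
    Finset.prod_range_add,
    mul_comm (∏ k ∈ Finset.range n, (1 - q ^ (2 * k + 1)))]
  have heven : ∏ k ∈ Finset.range n, (1 - (q ^ 2) ^ (k + 1)) =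
      ∏ k ∈ Finset.range n, (1 - q ^ (2 * k + 1 + 1)) :=
    Finset.prod_congr rfl fun k _ => by rw [← pow_mul]; ring_nf
  rw [heven, mul_div_mul_left _ _ (Finset.prod_ne_zero_iff.2 fun k _ => hne _ (by omega)),
    ← Finset.prod_div_distrib]
  refine Finset.prod_congr rfl fun k _ => ?_
  have hk := qn_ne_zero (n := 2 * k + 1) (by omega)
  rw [div_eq_iff (hne _ (by omega)), ← one_sub_mul_qn q (2 * k + 1)]
  have hP := one_sub_mul_qn q (n + n + 1)
  have hQ := one_sub_mul_qn q (2 * k + 1)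
  have hpow : (q ^ 2) ^ (n + k + 1) = q ^ (n + n + 1) * q ^ (2 * k + 1) := by
    rw [← pow_mul, ← pow_add]; ring_nf
  rw [hpow]
  field_simp
  linear_combination (-q ^ (2 * k + 1)) * hP - hQ

theorem exists_prod_one_add_mul_eq {R ι : Type*} [CommRing R] (S : Subring R) {P : R}
    (hP : P ∈ S) (s : Finset ι) {f : ι → R} (hf : ∀ i ∈ s, f i ∈ S) :
    ∃ r ∈ S, ∏ i ∈ s, (1 + P * f i) = 1 + P * ∑ i ∈ s, f i + P ^ 2 * r := by
  classical
  induction s using Finset.induction_on with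
  | empty => exact ⟨0, S.zero_mem, by simp⟩
  | insert a s ha ih =>
    obtain ⟨r, hr, h⟩ := ih fun i hi => hf i (Finset.mem_insert_of_mem hi)
    have hfa := hf a (Finset.mem_insert_self a s)
    have hsum := S.sum_mem fun i hi => hf i (Finset.mem_insert_of_mem hi)
    refine ⟨r + f a * ∑ i ∈ s, f i + P * (f a * r), S.add_mem (S.add_mem hr
      (S.mul_mem hfa hsum)) (S.mul_mem hP (S.mul_mem hfa hr)), ?_⟩
    rw [Finset.prod_insert ha, Finset.sum_insert ha, h]
    ring

theorem inv_qn_sq_add {i j : ℕ} (hi : i ≠ 0) (hj : j ≠ 0) :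
    1 / qn (q ^ 2) j + (1 + q) * (q ^ i * (qn q i)⁻¹) =
      qn q (i + 2 * j) * ((1 + q) * ((qn q i)⁻¹ * (qn q (2 * j))⁻¹)) := by
  have hi' := qn_ne_zero hi
  have hj' := qn_ne_zero (n := 2 * j) (by omega)
  rw [qn_add]
  rw [qn_two_mul] at hj' ⊢
  have h1 := left_ne_zero_of_mul hj'
  have h2 := right_ne_zero_of_mul hj'
  field_simp

theorem sum_inv_q_int_congruence (p : ℕ) (hp : p.Prime) (hp5 : 5 ≤ p) :
    qCong (pqn Polynomial.X p)
      (∑ j ∈ Finset.Icc 1 ((p - 1) / 2), 1 / qn (q ^ 2) j)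
      (-((1 + q) * QF p 2 q)) := by
  obtain ⟨n, rfl⟩ := hp.odd_of_ne_two (by omega)
  have hn : (2 * n + 1 - 1) / 2 = n := by omega
  have hP := qn_ne_zero (n := 2 * n + 1) (by omega)
  set S := coprimeDenomSubring (pqn X (2 * n + 1))
  have hq : q ∈ S := q_mem_coprimeDenomSubring _
  have hq1 : 1 + q ∈ S := S.add_mem S.one_mem hq
  have hinv : ∀ i, i ≠ 0 → i < 2 * n + 1 → (qn q i)⁻¹ ∈ S := fun i hi hip =>
    inv_qn_mem_coprimeDenomSubring hp hi hip
  obtain ⟨r, hr, hprod⟩ := exists_prod_one_add_mul_eq S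
    (P := qn q (2 * n + 1)) (S.sum_mem fun i _ => S.pow_mem hq i) (Finset.range n)
    (f := fun k => q ^ (2 * k + 1) * (qn q (2 * k + 1))⁻¹) fun k hk => by
      have := Finset.mem_range.1 hk
      exact S.mul_mem (S.pow_mem hq _) (hinv _ (by omega) (by omega))
  have hQF : QF (2 * n + 1) 2 q = ∑ k ∈ Finset.range n,
      q ^ (2 * k + 1) * (qn q (2 * k + 1))⁻¹ + qn q (2 * n + 1) * r := by
    rw [QF, Nat.add_sub_cancel, qpoch_sq_div_qpoch, hprod]
    field_simp
    ring
  have hreflect : ∑ j ∈ Finset.Icc 1 n, 1 / qn (q ^ 2) j =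
      ∑ k ∈ Finset.range n, 1 / qn (q ^ 2) (n - k) := by
    refine Finset.sum_bij' (fun j _ => n - j) (fun k _ => n - k) ?_ ?_ ?_ ?_ ?_ <;>
      simp only [Finset.mem_Icc, Finset.mem_range] <;> intro j hj
    · omega
    · omega
    · omega
    · omega
    · rw [Nat.sub_sub_self hj.2]
  have hsum : ∑ k ∈ Finset.range n, 1 / qn (q ^ 2) (n - k) +
      (1 + q) * ∑ k ∈ Finset.range n, q ^ (2 * k + 1) * (qn q (2 * k + 1))⁻¹ =
      qn q (2 * n + 1) * ∑ k ∈ Finset.range n,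
        (1 + q) * ((qn q (2 * k + 1))⁻¹ * (qn q (2 * (n - k)))⁻¹) := by
    rw [Finset.mul_sum, Finset.mul_sum, ← Finset.sum_add_distrib]
    refine Finset.sum_congr rfl fun k hk => ?_
    have := Finset.mem_range.1 hk
    rw [inv_qn_sq_add (by omega) (by omega),
      show 2 * k + 1 + 2 * (n - k) = 2 * n + 1 by omega]
  have hdiff : (∑ j ∈ Finset.Icc 1 n, 1 / qn (q ^ 2) j - -((1 + q) * QF (2 * n + 1) 2 q)) /
      qn q (2 * n + 1) = ∑ k ∈ Finset.range n,
        (1 + q) * ((qn q (2 * k + 1))⁻¹ * (qn q (2 * (n - k)))⁻¹) + (1 + q) * r := by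
    rw [div_eq_iff hP, hreflect, hQF]
    linear_combination hsum
  rw [qCong, algebraMap_pqn, hn, hdiff]
  refine S.add_mem (S.sum_mem fun k hk => ?_) (S.mul_mem hq1 hr)
  have := Finset.mem_range.1 hk
  exact S.mul_mem hq1 (S.mul_mem (hinv _ (by omega) (by omega)) (hinv _ (by omega) (by omega)))
end

section
/- Let p ≥ 5 be a prime, m an integer with p ∤ m, and m' a positive integer with m'·m ≡ 1 (mod p). Then Σ_{j∈R_p(m)} 1/[j]_{q^2} − Σ_{j∈R_p(−m)} 1/[j]_{q^2} ≡ (1−q^2)·|R_p(m)| + (1+q^{m'})·Q_p(2,q^{m'})/[m']_{q^2} (mod [p]_q). -/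
open Polynomial Finset

/-- The rational function `A` is regular at `z` and takes the value `v` there. -/
def HasValueAt (z : ℂ) (A : RatFunc ℚ) (v : ℂ) : Prop :=
  ∃ n d : ℚ[X], aeval z d ≠ 0 ∧
    A * algebraMap ℚ[X] (RatFunc ℚ) d = algebraMap ℚ[X] (RatFunc ℚ) n ∧
    v * aeval z d = aeval z n

namespace HasValueAt

variable {z v w : ℂ} {A B : RatFunc ℚ}

theorem algebraMap_aeval (z : ℂ) (f : ℚ[X]) :
    HasValueAt z (algebraMap ℚ[X] (RatFunc ℚ) f) (aeval z f) :=
  ⟨f, 1, by simp, by simp, by simp⟩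

theorem natCast (z : ℂ) (n : ℕ) : HasValueAt z (n : RatFunc ℚ) n := by
  simpa using algebraMap_aeval z (n : ℚ[X])

theorem one (z : ℂ) : HasValueAt z 1 1 := by
  simpa using algebraMap_aeval z 1

theorem zero (z : ℂ) : HasValueAt z 0 0 := by
  simpa using algebraMap_aeval z 0

theorem indeterminate (z : ℂ) : HasValueAt z q z := by
  simpa only [aeval_X, _root_.q] using algebraMap_aeval z X

theorem add (hA : HasValueAt z A v) (hB : HasValueAt z B w) : HasValueAt z (A + B) (v + w) := by
  obtain ⟨n, d, hd, h1, h2⟩ := hA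
  obtain ⟨k, e, he, h3, h4⟩ := hB
  refine ⟨n * e + k * d, d * e, by simp [hd, he], ?_, ?_⟩
  · simp only [map_add, map_mul, ← h1, ← h3]; ring
  · simp only [map_add, map_mul, ← h2, ← h4]; ring

theorem mul (hA : HasValueAt z A v) (hB : HasValueAt z B w) : HasValueAt z (A * B) (v * w) := by
  obtain ⟨n, d, hd, h1, h2⟩ := hA
  obtain ⟨k, e, he, h3, h4⟩ := hB
  refine ⟨n * k, d * e, by simp [hd, he], ?_, ?_⟩
  · simp only [map_mul, ← h1, ← h3]; ring
  · simp only [map_mul, ← h2, ← h4]; ring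

theorem neg (hA : HasValueAt z A v) : HasValueAt z (-A) (-v) := by
  obtain ⟨n, d, hd, h1, h2⟩ := hA
  exact ⟨-n, d, hd, by simp [← h1], by simp [← h2]⟩

theorem sub (hA : HasValueAt z A v) (hB : HasValueAt z B w) : HasValueAt z (A - B) (v - w) := by
  simpa only [sub_eq_add_neg] using hA.add hB.neg

theorem ne_zero (hA : HasValueAt z A v) (hv : v ≠ 0) : A ≠ 0 := by
  rintro rfl
  obtain ⟨n, d, hd, h1, h2⟩ := hA
  have hn : n = 0 := by simpa using h1.symm
  simp [hn, hd, hv] at h2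

theorem inv (hA : HasValueAt z A v) (hv : v ≠ 0) : HasValueAt z A⁻¹ v⁻¹ := by
  have hA0 := hA.ne_zero hv
  obtain ⟨n, d, hd, h1, h2⟩ := hA
  refine ⟨d, n, ?_, ?_, ?_⟩
  · rw [← h2]; exact mul_ne_zero hv hd
  · rw [← h1]; field_simp
  · rw [← h2]; field_simp

theorem div (hA : HasValueAt z A v) (hB : HasValueAt z B w) (hw : w ≠ 0) :
    HasValueAt z (A / B) (v / w) := by
  simpa only [div_eq_mul_inv] using hA.mul (hB.inv hw)

theorem pow (hA : HasValueAt z A v) (n : ℕ) : HasValueAt z (A ^ n) (v ^ n) := by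
  induction n with
  | zero => simpa using one z
  | succ n ih => simpa only [pow_succ] using ih.mul hA

theorem sum {ι : Type*} (s : Finset ι) {A : ι → RatFunc ℚ} {v : ι → ℂ}
    (h : ∀ i ∈ s, HasValueAt z (A i) (v i)) :
    HasValueAt z (∑ i ∈ s, A i) (∑ i ∈ s, v i) := by
  classical
  induction s using Finset.induction_on with
  | empty => simpa using zero z
  | insert i s hi ih =>
    rw [Finset.sum_insert hi, Finset.sum_insert hi]
    exact (h i (Finset.mem_insert_self i s)).add
      (ih fun j hj => h j (Finset.mem_insert_of_mem hj))

theorem qInt (hA : HasValueAt z A v) (n : ℕ) :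
    HasValueAt z (qn A n) (∑ i ∈ Finset.range n, v ^ i) :=
  sum _ fun i _ => hA.pow i

end HasValueAt

theorem qCong_of_hasValueAt {p : ℕ} (hp : p.Prime) {z v : ℂ} (hz : IsPrimitiveRoot z p)
    {A B : RatFunc ℚ} (hA : HasValueAt z A v) (hB : HasValueAt z B v) :
    qCong (pqn X p) A B := by
  have := Fact.mk hp
  have hcyc : pqn X p = cyclotomic p ℚ := (cyclotomic_prime ℚ p).symm
  have hirr : Irreducible (pqn X p) := hcyc ▸ cyclotomic.irreducible_rat hp.pos
  have hmin : pqn X p = minpoly ℚ z := hcyc.trans (cyclotomic_eq_minpoly_rat hz hp.pos)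
  obtain ⟨n, d, hd, h1, h2⟩ := hA.sub hB
  have hn : pqn X p ∣ n := by
    rw [hmin]; exact minpoly.dvd ℚ z (by simpa using h2.symm)
  obtain ⟨k, rfl⟩ := hn
  have hd0 : d ≠ 0 := by rintro rfl; simp at hd
  have hquot : (A - B) / algebraMap ℚ[X] (RatFunc ℚ) (pqn X p) =
      algebraMap ℚ[X] (RatFunc ℚ) k / algebraMap ℚ[X] (RatFunc ℚ) d := by
    rw [div_eq_div_iff (RatFunc.algebraMap_ne_zero hirr.ne_zero) (RatFunc.algebraMap_ne_zero hd0),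
      h1, map_mul, mul_comm]
  have hcop : IsCoprime d (pqn X p) := by
    refine ((hirr.coprime_iff_not_dvd).2 fun hdvd => hd ?_).symm
    obtain ⟨c, rfl⟩ := hdvd
    rw [hmin]; simp
  rw [qCong, hquot]
  exact hcop.of_isCoprime_of_dvd_left (RatFunc.denom_div_dvd k d)

/-- Multiplication by a residue prime to `p` permutes the nonzero residues mod `p`. -/
theorem bijOn_mul_mod {p c : ℕ} (hp : p.Prime) (hc : p.Coprime c) :
    Set.BijOn (fun i => c * i % p) (Finset.Icc 1 (p - 1)) (Finset.Icc 1 (p - 1)) := by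
  have hp1 := hp.one_lt
  have hmaps : Set.MapsTo (fun i => c * i % p) (Finset.Icc 1 (p - 1)) (Finset.Icc 1 (p - 1)) := by
    intro i hi
    simp only [Finset.coe_Icc, Set.mem_Icc] at hi ⊢
    have hlt := Nat.mod_lt (c * i) hp.pos
    have hne : c * i % p ≠ 0 := fun h0 => by
      have := Nat.le_of_dvd (by omega) (hc.dvd_of_dvd_mul_left (Nat.dvd_of_mod_eq_zero h0))
      omega
    omega
  have hinj : Set.InjOn (fun i => c * i % p) (Finset.Icc 1 (p - 1)) := by
    intro i hi j hj hij
    simp only [Finset.coe_Icc, Set.mem_Icc] at hi hj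
    have : i ≡ j [MOD p] := Nat.ModEq.cancel_left_of_coprime hc hij
    exact Nat.ModEq.eq_of_lt_of_lt this (by omega) (by omega)
  exact ⟨hmaps, hinj, Finset.surjOn_of_injOn_of_card_le _ hmaps hinj le_rfl⟩

section RootsOfUnity

variable {p : ℕ} {w : ℂ}

theorem one_sub_pow_ne_zero (hw : IsPrimitiveRoot w p) {k : ℕ} (hk : ¬ p ∣ k) : 1 - w ^ k ≠ 0 :=
  fun h => hk (hw.dvd_of_pow_eq_one k (sub_eq_zero.1 h).symm)

theorem prod_one_add_pow (hp : p.Prime) (hodd : Odd p) (hw : IsPrimitiveRoot w p) :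
    ∏ i ∈ Finset.Icc 1 (p - 1), (1 + w ^ i) = 1 := by
  have hne : ∀ i ∈ Finset.Icc 1 (p - 1), 1 - w ^ i ≠ 0 := fun i hi => by
    rw [Finset.mem_Icc] at hi
    exact one_sub_pow_ne_zero hw (Nat.not_dvd_of_pos_of_lt (by omega) (by omega))
  refine mul_left_cancel₀ (Finset.prod_ne_zero_iff.2 hne) ?_
  rw [mul_one, ← Finset.prod_mul_distrib]
  have hb := bijOn_mul_mod hp (c := 2) (Nat.coprime_two_right.2 hodd)
  refine Finset.prod_nbij _ hb.mapsTo hb.injOn hb.surjOn fun i _ => ?_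
  rw [pow_eq_pow_of_modEq (Nat.mod_modEq (2 * i) p) hw.pow_eq_one]
  ring

/-- `∑_{i=1}^{p-1} i wⁱ / (1 + wⁱ) = p ∑_{r=1}^{(p-1)/2} 1 / (1 - w^{2r})`. -/
theorem sum_mul_pow_div_one_add_pow (hp : p.Prime) {h : ℕ} (hph : p = 2 * h + 1)
    (hw : IsPrimitiveRoot w p) :
    ∑ i ∈ Finset.Icc 1 (p - 1), (i : ℂ) * w ^ i / (1 + w ^ i) =
      p * ∑ r ∈ Finset.Icc 1 h, 1 / (1 - w ^ (2 * r)) := by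
  have hcop : p.Coprime 2 := Nat.coprime_two_right.2 ⟨h, hph⟩
  have hndvd : ∀ i ∈ Finset.Icc 1 (p - 1), ¬ p ∣ i := fun i hi => by
    rw [Finset.mem_Icc] at hi
    exact Nat.not_dvd_of_pos_of_lt (by omega) (by omega)
  have hne1 : ∀ i ∈ Finset.Icc 1 (p - 1), 1 - w ^ i ≠ 0 := fun i hi =>
    one_sub_pow_ne_zero hw (hndvd i hi)
  have hne2 : ∀ i ∈ Finset.Icc 1 (p - 1), 1 - w ^ (2 * i) ≠ 0 := fun i hi =>
    one_sub_pow_ne_zero hw fun hd => hndvd i hi (hcop.dvd_of_dvd_mul_left hd)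
  have hterm : ∀ i ∈ Finset.Icc 1 (p - 1), (i : ℂ) * w ^ i / (1 + w ^ i) =
      i - (2 * i : ℕ) / (1 - w ^ (2 * i)) + i / (1 - w ^ i) := fun i hi => by
    have h1 := hne1 i hi
    have h2 := hne2 i hi
    have hf : 1 - w ^ (2 * i) = (1 - w ^ i) * (1 + w ^ i) := by ring
    rw [hf] at h2 ⊢
    have h3 := right_ne_zero_of_mul h2
    push_cast
    field_simp
    ring
  have hdouble : ∑ i ∈ Finset.Icc 1 (p - 1), ((2 * i % p : ℕ) : ℂ) / (1 - w ^ (2 * i)) =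
      ∑ i ∈ Finset.Icc 1 (p - 1), (i : ℂ) / (1 - w ^ i) := by
    have hb := bijOn_mul_mod hp hcop
    refine Finset.sum_nbij _ hb.mapsTo hb.injOn hb.surjOn fun i _ => ?_
    rw [pow_eq_pow_of_modEq (Nat.mod_modEq (2 * i) p) hw.pow_eq_one]
  have hsplit : ∀ f : ℕ → ℂ, ∑ i ∈ Finset.Icc 1 (p - 1), f i =
      ∑ i ∈ Finset.Icc 1 h, (f i + f (p - i)) := fun f => by
    have hu : Finset.Icc 1 (p - 1) = Finset.Icc 1 h ∪ Finset.Icc (h + 1) (p - 1) := by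
      ext i; simp only [Finset.mem_Icc, Finset.mem_union]; omega
    have hd : Disjoint (Finset.Icc 1 h) (Finset.Icc (h + 1) (p - 1)) := by
      rw [Finset.disjoint_left]; intro i; simp only [Finset.mem_Icc]; omega
    rw [hu, Finset.sum_union hd, Finset.sum_add_distrib]
    congr 1
    refine Finset.sum_nbij' (fun i => p - i) (fun i => p - i) ?_ ?_ ?_ ?_ ?_ <;>
      intro i hi <;> simp only [Finset.mem_Icc] at hi ⊢
    · omega
    · omega
    · omega
    · omega
    · congr 1; omega
  rw [Finset.sum_congr rfl hterm, Finset.sum_add_distrib, ← hdouble, ← Finset.sum_add_distrib,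
    hsplit, Finset.mul_sum]
  refine Finset.sum_congr rfl fun i hi => ?_
  have hmem : i ∈ Finset.Icc 1 (p - 1) := by
    rw [Finset.mem_Icc] at hi ⊢; omega
  rw [Finset.mem_Icc] at hi
  have hmem' : p - i ∈ Finset.Icc 1 (p - 1) := by
    rw [Finset.mem_Icc]; omega
  have h1 := hne2 i hmem
  have h2 := hne2 _ hmem'
  have hinv : w ^ (2 * i) * w ^ (2 * (p - i)) = 1 := by
    rw [← pow_add, show 2 * i + 2 * (p - i) = p * 2 by omega, pow_mul, hw.pow_eq_one, one_pow]
  have hm1 : 2 * i % p = 2 * i := Nat.mod_eq_of_lt (by omega)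
  have hm2 : 2 * (p - i) % p = p - 2 * i := by
    rw [show 2 * (p - i) = p + (p - 2 * i) by omega, Nat.add_mod_left]
    exact Nat.mod_eq_of_lt (by omega)
  have hrefl : 1 / (1 - w ^ (2 * (p - i))) = 1 - 1 / (1 - w ^ (2 * i)) := by
    field_simp
    linear_combination -hinv
  rw [hm1, hm2]
  push_cast [Nat.cast_sub (show i ≤ p by omega), Nat.cast_sub (show 2 * i ≤ p by omega)]
  linear_combination (-(p : ℂ)) * hrefl

end RootsOfUnity

/-- The `q`-Fermat quotient of `2` to base `a = q^k` is a polynomial in `a`. -/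
theorem QF_two_eq {p k : ℕ} (hp : p.Prime) (hk : 0 < k) {F : ℚ[X]}
    (hF : ∏ i ∈ Finset.Icc 1 (p - 1), (1 + X ^ i) - 1 = (∑ i ∈ Finset.range p, X ^ i) * F) :
    QF p 2 (q ^ k) = algebraMap ℚ[X] (RatFunc ℚ) (expand ℚ k F) := by
  have hmap : q ^ k = algebraMap ℚ[X] (RatFunc ℚ) (X ^ k) := by simp [q]
  have hcomp := congrArg (fun f : ℚ[X] => algebraMap ℚ[X] (RatFunc ℚ) (expand ℚ k f)) hF
  have hpow : ∀ j, 0 < j → (q ^ k) ^ j ≠ 1 := fun j hj h => by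
    rw [hmap, ← map_pow, ← map_one (algebraMap ℚ[X] (RatFunc ℚ)), ← pow_mul] at h
    have := congrArg natDegree (RatFunc.algebraMap_injective ℚ h)
    rw [natDegree_X_pow, natDegree_one] at this
    exact (Nat.mul_pos hk hj).ne' this
  simp only [map_sub, map_mul, map_one, map_prod, map_sum, map_add, map_pow, expand_X] at hcomp
  rw [map_pow] at hmap
  simp only [← hmap] at hcomp
  have hqn : qn (q ^ k) p ≠ 0 := fun h => by
    refine hpow p hp.pos (sub_eq_zero.1 ?_)
    rw [← geom_sum_mul, show ∑ i ∈ Finset.range p, (q ^ k) ^ i = 0 from h, zero_mul]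
  have hprod : qpoch ((q ^ k) ^ 2) ((q ^ k) ^ 2) (p - 1) / qpoch (q ^ k) (q ^ k) (p - 1) =
      ∏ i ∈ Finset.Icc 1 (p - 1), (1 + (q ^ k) ^ i) := by
    rw [← Finset.Ico_succ_right_eq_Icc, Finset.prod_Ico_eq_prod_range, qpoch, qpoch,
      ← Finset.prod_div_distrib]
    refine Finset.prod_congr (by simp) fun i _ => ?_
    have : 1 - q ^ k * (q ^ k) ^ i ≠ 0 := by
      rw [← pow_succ', sub_ne_zero]; exact (hpow _ i.succ_pos).symm
    rw [div_eq_iff this]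
    ring
  rw [QF, hprod, div_eq_iff hqn, mul_comm, qn]
  exact hcomp

theorem exists_fermatQuotient_two {p : ℕ} (hp : p.Prime) (hodd : Odd p) :
    ∃ F : ℚ[X], ∏ i ∈ Finset.Icc 1 (p - 1), (1 + X ^ i) - 1 =
      (∑ i ∈ Finset.range p, X ^ i) * F := by
  have := Fact.mk hp
  have hz := Complex.isPrimitiveRoot_exp p hp.ne_zero
  rw [← cyclotomic_prime ℚ p, cyclotomic_eq_minpoly_rat hz hp.pos]
  refine minpoly.dvd ℚ _ ?_
  simp only [map_sub, map_prod, map_add, map_one, map_pow, aeval_X]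
  rw [prod_one_add_pow hp hodd hz, sub_self]

/-- The value of the polynomial `q`-Fermat quotient of `2` at a primitive `p`-th root of unity. -/
theorem aeval_fermatQuotient_two {p h : ℕ} (hp : p.Prime) (hph : p = 2 * h + 1) {w : ℂ}
    (hw : IsPrimitiveRoot w p) {F : ℚ[X]}
    (hF : ∏ i ∈ Finset.Icc 1 (p - 1), (1 + X ^ i) - 1 = (∑ i ∈ Finset.range p, X ^ i) * F) :
    aeval w F = (w - 1) * ∑ r ∈ Finset.Icc 1 h, 1 / (1 - w ^ (2 * r)) := by
  have hp0 : (p : ℂ) ≠ 0 := Nat.cast_ne_zero.2 hp.ne_zero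
  have hprod := prod_one_add_pow hp ⟨h, hph⟩ hw
  have hne : ∀ i ∈ Finset.Icc 1 (p - 1), 1 + w ^ i ≠ 0 :=
    Finset.prod_ne_zero_iff.1 (by rw [hprod]; exact one_ne_zero)
  have hgeom : ((∑ i ∈ Finset.range p, X ^ i) * (X - 1) : ℚ[X]) = X ^ p - 1 := geom_sum_mul X p
  have hsum : ∑ i ∈ Finset.range p, w ^ i = 0 := hw.geom_sum_eq_zero hp.one_lt
  have hd1 := congrArg (fun f : ℚ[X] => aeval w (derivative f)) hgeom
  have hd2 := congrArg (fun f : ℚ[X] => w * aeval w (derivative f)) hF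
  have hS := sum_mul_pow_div_one_add_pow hp hph hw
  have hderiv : w * aeval w (derivative (∏ i ∈ Finset.Icc 1 (p - 1), (1 + X ^ i) : ℚ[X])) =
      ∑ i ∈ Finset.Icc 1 (p - 1), (i : ℂ) * w ^ i / (1 + w ^ i) := by
    rw [derivative_prod_finset, map_sum, Finset.mul_sum]
    refine Finset.sum_congr rfl fun i hi => ?_
    have hi1 := (Finset.mem_Icc.1 hi).1
    have hsplit := Finset.mul_prod_erase _ (fun i => 1 + w ^ i) hi
    rw [hprod] at hsplit
    have hpw : w * w ^ (i - 1) = w ^ i := by rw [← pow_succ', Nat.sub_add_cancel hi1]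
    have hni := hne i hi
    rw [eq_div_iff hni]
    simp only [map_mul, map_prod, map_add, map_one, map_pow, aeval_X,
      derivative_one, derivative_X_pow, zero_add, map_natCast]
    linear_combination ((i : ℂ) * (w * w ^ (i - 1))) * hsplit + (i : ℂ) * hpw
  have hpw : w * w ^ (p - 1) = 1 := by
    rw [← pow_succ', Nat.sub_add_cancel hp.pos, hw.pow_eq_one]
  simp only [derivative_mul, derivative_X, derivative_one, derivative_X_pow,
    map_add, map_mul, map_sub, map_one, map_pow, map_sum, aeval_X, hsum, sub_zero, zero_mul,
    mul_one, add_zero, map_natCast] at hd1 hd2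
  rw [hderiv, hS] at hd2
  refine mul_left_cancel₀ hp0 ?_
  linear_combination (-(w - 1)) * hd2 - (w * aeval w F) * hd1 - (p * aeval w F) * hpw

section Residues

variable {p : ℕ} {m : ℤ}

theorem res_cast (hp : 0 < p) (x : ℤ) : (res p x : ℤ) = x % p :=
  Int.toNat_of_nonneg (Int.emod_nonneg _ (by omega))

theorem res_lt (hp : 0 < p) (x : ℤ) : res p x < p := by
  have := Int.emod_lt_of_pos x (show (0 : ℤ) < p by omega)
  have := res_cast hp x
  omega

theorem res_pos (hp : 0 < p) {x : ℤ} (hx : ¬ (p : ℤ) ∣ x) : 0 < res p x := by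
  have := res_cast hp x
  have : x % (p : ℤ) ≠ 0 := fun h => hx (Int.dvd_of_emod_eq_zero h)
  omega

theorem res_modEq (hp : 0 < p) (x : ℤ) : (res p x : ℤ) ≡ x [ZMOD p] := by
  rw [res_cast hp]; exact Int.mod_modEq x p

theorem res_neg (hp : 0 < p) {x : ℤ} (hx : ¬ (p : ℤ) ∣ x) : res p (-x) = p - res p x := by
  have h1 := res_modEq hp x
  have h2 := res_modEq hp (-x)
  have hx' : ¬ (p : ℤ) ∣ -x := by rwa [dvd_neg]
  have h3 : (p : ℤ) ∣ (res p x + res p (-x) : ℤ) := by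
    rw [← Int.modEq_zero_iff_dvd]
    simpa using h1.add h2
  obtain ⟨c, hc⟩ := h3
  have := res_lt hp x
  have := res_lt hp (-x)
  have := res_pos hp hx
  have := res_pos hp hx'
  have hc1 : c = 1 := by
    have : 0 < c := by by_contra! h0; nlinarith
    have : c < 2 := by by_contra! h0; nlinarith
    omega
  subst hc1
  omega

theorem not_dvd_natCast_mul (hp : p.Prime) (hpm : ¬ (p : ℤ) ∣ m) {j : ℕ} (h0 : 0 < j)
    (hj : j < p) : ¬ (p : ℤ) ∣ j * m := fun h =>
  ((Nat.prime_iff_prime_int.1 hp).dvd_or_dvd h).elim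
    (fun h => Nat.not_dvd_of_pos_of_lt h0 hj (Int.natCast_dvd_natCast.1 h)) hpm

/-- The absolute value of the residue of `j * m` of least absolute value modulo `p`. -/
def absRes (p : ℕ) (m : ℤ) (j : ℕ) : ℕ :=
  if p < 2 * res p (j * m) then p - res p (j * m) else res p (j * m)

theorem absRes_modEq (hp : 0 < p) (m : ℤ) (j : ℕ) :
    (absRes p m j : ℤ) ≡ j * m [ZMOD p] ∨ (absRes p m j : ℤ) ≡ -(j * m) [ZMOD p] := by
  unfold absRes
  split_ifs
  · right
    rw [Nat.cast_sub (res_lt hp _).le]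
    simpa using (Int.modEq_zero_iff_dvd.2 (dvd_refl (p : ℤ))).sub (res_modEq hp (j * m))
  · exact Or.inl (res_modEq hp _)

theorem bijOn_absRes (hp : p.Prime) {h : ℕ} (hph : p = 2 * h + 1) (hpm : ¬ (p : ℤ) ∣ m) :
    Set.BijOn (absRes p m) (Finset.Icc 1 h) (Finset.Icc 1 h) := by
  have hmaps : Set.MapsTo (absRes p m) (Finset.Icc 1 h) (Finset.Icc 1 h) := by
    intro j hj
    simp only [Finset.coe_Icc, Set.mem_Icc] at hj ⊢
    have := res_lt hp.pos (j * m)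
    have := res_pos hp.pos (not_dvd_natCast_mul hp hpm (j := j) (by omega) (by omega))
    unfold absRes
    split_ifs <;> omega
  have hinj : Set.InjOn (absRes p m) (Finset.Icc 1 h) := by
    intro i hi j hj hij
    simp only [Finset.coe_Icc, Set.mem_Icc] at hi hj
    have hsub : (p : ℤ) ∣ (i - j) * m ∨ (p : ℤ) ∣ (i + j) * m := by
      have hi' := absRes_modEq hp.pos m i
      rw [hij] at hi'
      rcases hi' with hi' | hi' <;> rcases absRes_modEq hp.pos m j with hj' | hj'
      · left; have := (hj'.symm.trans hi').dvd; ring_nf at this ⊢; exact this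
      · right; have := (hj'.symm.trans hi').dvd; ring_nf at this ⊢; exact this
      · right
        have := (hi'.symm.trans hj').dvd; ring_nf at this ⊢; exact this
      · left
        have := (hi'.symm.trans hj').dvd; ring_nf at this ⊢; exact this
    have hprime := Nat.prime_iff_prime_int.1 hp
    rcases hsub with hd | hd
    · have hd := (hprime.dvd_or_dvd hd).resolve_right hpm
      have := Int.eq_zero_of_abs_lt_dvd hd (by rw [abs_lt]; constructor <;> omega)
      omega
    · have hd := (hprime.dvd_or_dvd hd).resolve_right hpm
      have := Int.le_of_dvd (by omega) hd
      omega
  exact ⟨hmaps, hinj, Finset.surjOn_of_injOn_of_card_le _ hmaps hinj le_rfl⟩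

theorem Rset_neg (hp : p.Prime) (hpm : ¬ (p : ℤ) ∣ m) {h : ℕ} (hph : p = 2 * h + 1) :
    Rset p (-m) = (Finset.Icc 1 h).filter fun j : ℕ => ¬ p < 2 * res p ((j : ℤ) * m) := by
  have hh : (p - 1) / 2 = h := by omega
  unfold Rset
  rw [hh]
  refine Finset.filter_congr fun j hj => ?_
  rw [Finset.mem_Icc] at hj
  have hx := not_dvd_natCast_mul hp hpm (j := j) (by omega) (by omega)
  have := res_lt hp.pos (j * m)
  rw [mul_neg, res_neg hp.pos hx]
  omega

theorem sum_Rset_sub_sum_Rset_neg_root (hp : p.Prime) {h : ℕ} (hph : p = 2 * h + 1)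
    (hpm : ¬ (p : ℤ) ∣ m) {m' : ℕ} (hinv : (m' : ℤ) * m ≡ 1 [ZMOD (p : ℤ)]) {z : ℂ}
    (hz : IsPrimitiveRoot z p) :
    ∑ j ∈ Rset p m, 1 / (1 - z ^ (2 * j)) - ∑ j ∈ Rset p (-m), 1 / (1 - z ^ (2 * j)) =
      (Rset p m).card - ∑ r ∈ Finset.Icc 1 h, 1 / (1 - (z ^ m') ^ (2 * r)) := by
  have hh : (p - 1) / 2 = h := by omega
  have hb := bijOn_absRes hp hph hpm
  have hreindex : ∑ r ∈ Finset.Icc 1 h, 1 / (1 - (z ^ m') ^ (2 * r)) =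
      ∑ j ∈ Finset.Icc 1 h, 1 / (1 - (z ^ m') ^ (2 * absRes p m j)) :=
    (Finset.sum_nbij _ hb.mapsTo hb.injOn hb.surjOn fun _ _ => rfl).symm
  have hres : ∀ j : ℕ, (z ^ m') ^ res p (j * m) = z ^ j := fun j => by
    rw [← pow_mul]
    refine pow_eq_pow_of_modEq (Int.natCast_modEq_iff.1 ?_) hz.pow_eq_one
    push_cast
    calc (m' : ℤ) * res p (j * m) ≡ m' * (j * m) [ZMOD p] := (res_modEq hp.pos _).mul_left _
      _ = m' * m * j := by ring
      _ ≡ 1 * j [ZMOD p] := hinv.mul_right _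
      _ = j := one_mul _
  have hpos : ∑ j ∈ Rset p m, 1 / (1 - (z ^ m') ^ (2 * absRes p m j)) =
      ∑ j ∈ Rset p m, (1 - 1 / (1 - z ^ (2 * j))) := by
    refine Finset.sum_congr rfl fun j hj => ?_
    rw [Rset, hh, Finset.mem_filter, Finset.mem_Icc] at hj
    have hodd : p.Coprime 2 := Nat.coprime_two_right.2 ⟨h, hph⟩
    have hprod : (z ^ m') ^ (2 * absRes p m j) * z ^ (2 * j) = 1 := by
      rw [absRes, if_pos hj.2, mul_comm 2, mul_comm 2, pow_mul, pow_mul, ← mul_pow,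
        ← hres j, ← pow_add, Nat.sub_add_cancel (res_lt hp.pos _).le,
        pow_right_comm z m' p, hz.pow_eq_one, one_pow, one_pow]
    have h1 : 1 - z ^ (2 * j) ≠ 0 := one_sub_pow_ne_zero hz fun hd =>
      Nat.not_dvd_of_pos_of_lt (by omega) (by omega) (hodd.dvd_of_dvd_mul_left hd)
    have h2 : 1 - (z ^ m') ^ (2 * absRes p m j) ≠ 0 := fun h0 => h1 <| by
      rw [sub_eq_zero] at h0 ⊢
      rw [← hprod, ← h0, one_mul]
    field_simp
    linear_combination -hprod
  have hneg : ∑ j ∈ Rset p (-m), 1 / (1 - (z ^ m') ^ (2 * absRes p m j)) =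
      ∑ j ∈ Rset p (-m), 1 / (1 - z ^ (2 * j)) := by
    refine Finset.sum_congr rfl fun j hj => ?_
    rw [Rset_neg hp hpm hph, Finset.mem_filter] at hj
    rw [absRes, if_neg hj.2, mul_comm 2, mul_comm 2, pow_mul, pow_mul, hres]
  rw [hreindex, ← Finset.sum_filter_add_sum_filter_not (Finset.Icc 1 h)
    (fun j : ℕ => p < 2 * res p ((j : ℤ) * m)), ← Rset_neg hp hpm hph,
    show (Finset.Icc 1 h).filter (fun j : ℕ => p < 2 * res p ((j : ℤ) * m)) = Rset p m by
      rw [Rset, hh], hpos, hneg, Finset.sum_sub_distrib, Finset.sum_const, nsmul_one]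
  ring

end Residues

theorem hasValueAt_qn_sq {p : ℕ} {z : ℂ} (hz : IsPrimitiveRoot z p) (hodd : p.Coprime 2)
    (hp : p ≠ 1) (j : ℕ) :
    HasValueAt z (qn (q ^ 2) j) ((1 - z ^ (2 * j)) / (1 - z ^ 2)) := by
  have h1 : 1 - z ^ 2 ≠ 0 := one_sub_pow_ne_zero hz fun hd => hp (hodd.eq_one_of_dvd hd)
  rw [pow_mul, show (1 - (z ^ 2) ^ j) / (1 - z ^ 2) = ∑ i ∈ Finset.range j, (z ^ 2) ^ i by
    rw [div_eq_iff h1, ← mul_neg_geom_sum, mul_comm]]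
  exact ((HasValueAt.indeterminate z).pow 2).qInt j

theorem sum_Rset_sub_sum_Rset_neg (p : ℕ) (hp : p.Prime) (hp5 : 5 ≤ p)
    (m : ℤ) (hpm : ¬ (p : ℤ) ∣ m) (m' : ℕ) (hm' : 0 < m')
    (hinv : (m' : ℤ) * m ≡ 1 [ZMOD (p : ℤ)]) :
    qCong (pqn Polynomial.X p)
      (∑ j ∈ Rset p m, 1 / qn (q ^ 2) j - ∑ j ∈ Rset p (-m), 1 / qn (q ^ 2) j)
      ((1 - q ^ 2) * ((Rset p m).card : RatFunc ℚ) +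
        (1 + q ^ m') * QF p 2 (q ^ m') / qn (q ^ 2) m') := by
  obtain ⟨h, hph⟩ := hp.odd_of_ne_two (by omega)
  have hodd : p.Coprime 2 := Nat.coprime_two_right.2 ⟨h, hph⟩
  have hz := Complex.isPrimitiveRoot_exp p hp.ne_zero
  generalize Complex.exp (2 * Real.pi * Complex.I / p) = z at hz
  have hz2 : 1 - z ^ 2 ≠ 0 := one_sub_pow_ne_zero hz fun hd => by
    have := Nat.le_of_dvd two_pos hd
    omega
  have hndvd : ¬ p ∣ m' := fun hd => by
    have h0 : (m' : ℤ) * m ≡ 0 [ZMOD p] :=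
      Int.modEq_zero_iff_dvd.2 ((Int.natCast_dvd_natCast.2 hd).mul_right m)
    have := Int.le_of_dvd one_pos (Int.modEq_zero_iff_dvd.1 (hinv.symm.trans h0))
    omega
  have hw : IsPrimitiveRoot (z ^ m') p :=
    hz.pow_of_coprime m' ((hp.coprime_iff_not_dvd.2 hndvd).symm)
  have hqn0 : ∀ j, ¬ p ∣ j → (1 - z ^ (2 * j)) / (1 - z ^ 2) ≠ 0 := fun j hj =>
    div_ne_zero (one_sub_pow_ne_zero hz fun hd => hj (hodd.dvd_of_dvd_mul_left hd)) hz2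
  have hsum : ∀ n : ℤ, HasValueAt z (∑ j ∈ Rset p n, 1 / qn (q ^ 2) j)
      ((1 - z ^ 2) * ∑ j ∈ Rset p n, 1 / (1 - z ^ (2 * j))) := fun n => by
    rw [Finset.mul_sum]
    refine HasValueAt.sum _ fun j hj => ?_
    rw [Rset, Finset.mem_filter, Finset.mem_Icc] at hj
    have hj' : ¬ p ∣ j := Nat.not_dvd_of_pos_of_lt (by omega) (by omega)
    rw [mul_one_div, ← one_div_div (1 - z ^ (2 * j))]
    exact (HasValueAt.one z).div (hasValueAt_qn_sq hz hodd hp.ne_one j) (hqn0 j hj')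
  obtain ⟨F, hF⟩ := exists_fermatQuotient_two hp ⟨h, hph⟩
  have hQF : HasValueAt z (QF p 2 (q ^ m')) (aeval (z ^ m') F) := by
    rw [QF_two_eq hp hm' hF]
    simpa only [expand_aeval] using HasValueAt.algebraMap_aeval z (expand ℚ m' F)
  have hq := HasValueAt.indeterminate z
  have hone := HasValueAt.one z
  have hleft := (hsum m).sub (hsum (-m))
  have hright := ((hone.sub (hq.pow 2)).mul (HasValueAt.natCast z (Rset p m).card)).add
    (((hone.add (hq.pow m')).mul hQF).div (hasValueAt_qn_sq hz hodd hp.ne_one m')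
      (hqn0 m' hndvd))
  refine qCong_of_hasValueAt hp hz hleft ?_
  convert hright using 1
  rw [← mul_sub, sum_Rset_sub_sum_Rset_neg_root hp hph hpm hinv hz,
    aeval_fermatQuotient_two hp hph hw hF]
  have h1 : 1 - z ^ (2 * m') ≠ 0 := one_sub_pow_ne_zero hz fun hd =>
    hndvd (hodd.dvd_of_dvd_mul_left hd)
  generalize ∑ r ∈ Finset.Icc 1 h, 1 / (1 - (z ^ m') ^ (2 * r)) = S
  field_simp
  ring
end
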